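/- For any planar packing V ⊆ ℝ² (pairwise distances ≥ 2), there exists c such that for all r ≥ 1, card(V ∩ B(0,r)) ≤ π r²/√12 + c·r. (Two-dimensional analogue of the Kepler conjecture, credited to Thue.) -/

import Mathlib

open Real Metric
open MeasureTheory

/-- The truncation radius is the circumradius `√(4/3)` of the equilateral triangle of side `2`. -/
theorem not_three_close {E : Type*} [NormedAddCommGroup E] [InnerProductSpace ℝ E] {p q s : E}
    (hp : ‖p‖ ^ 2 ≤ 4 / 3) (hq : ‖q‖ ^ 2 < 4 / 3) (hs : ‖s‖ ^ 2 ≤ 4 / 3)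
    (hpq : 2 ≤ ‖p - q‖) (hps : 2 ≤ ‖p - s‖) (hqs : 2 ≤ ‖q - s‖) : False := by
  have h1 := norm_sub_sq_real p q
  have h2 := norm_sub_sq_real p s
  have h3 := norm_sub_sq_real q s
  have h4 := norm_add_sq_real (p + q) s
  have h5 := norm_add_sq_real p q
  rw [inner_add_left] at h4
  nlinarith [sq_nonneg ‖p + q + s‖]

/-- The part of the ball of radius `√(4/3)` that is at least as close to `u` as to the origin. -/
def cap {E : Type*} [NormedAddCommGroup E] (u : E) : Set E :=
  {x | ‖x‖ < √(4 / 3) ∧ ‖x - u‖ ≤ ‖x‖}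

/-- The circular sector of radius `√(4/3)` around the origin spanned by `cap u`. -/
def capSector {E : Type*} [NormedAddCommGroup E] [InnerProductSpace ℝ E] (u : E) : Set E :=
  {x | ‖x‖ < √(4 / 3) ∧ ‖x‖ * ‖u‖ ^ 2 / 2 < √(4 / 3) * inner ℝ x u}

theorem capSector_subset_ball {E : Type*} [NormedAddCommGroup E] [InnerProductSpace ℝ E] (u : E) :
    capSector u ⊆ ball 0 (√(4 / 3)) := fun x hx => by simpa using hx.1

theorem isOpen_capSector {E : Type*} [NormedAddCommGroup E] [InnerProductSpace ℝ E] (u : E) :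
    IsOpen (capSector u) :=
  .inter (s := {x | ‖x‖ < √(4 / 3)})
    (t := {x | ‖x‖ * ‖u‖ ^ 2 / 2 < √(4 / 3) * inner ℝ x u})
    (isOpen_lt (by fun_prop) (by fun_prop)) (isOpen_lt (by fun_prop) (by fun_prop))

theorem cap_subset_ball {E : Type*} [NormedAddCommGroup E] (u : E) :
    cap u ⊆ ball 0 (√(4 / 3)) := fun x hx => by simpa using hx.1

theorem disjoint_capSector {E : Type*} [NormedAddCommGroup E] [InnerProductSpace ℝ E] {u w : E}
    (hu : 2 ≤ ‖u‖) (hw : 2 ≤ ‖w‖) (huw : 2 ≤ ‖u - w‖) :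
    Disjoint (capSector u) (capSector w) := by
  rw [Set.disjoint_left]
  rintro x ⟨-, hxu⟩ ⟨-, hxw⟩
  have hR : √(4 / 3 : ℝ) ^ 2 = 4 / 3 := Real.sq_sqrt (by norm_num)
  have hx : 0 < ‖x‖ := by
    rw [norm_pos_iff]
    rintro rfl
    simp at hxu
  set y : E := (√(4 / 3) / ‖x‖) • x with hy
  have hny : ‖y‖ = √(4 / 3) := by
    rw [hy, norm_smul, Real.norm_of_nonneg (by positivity)]
    field_simp
  have key : ∀ z : E, ‖x‖ * ‖z‖ ^ 2 / 2 < √(4 / 3) * inner ℝ x z → ‖z - y‖ ^ 2 < 4 / 3 := by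
    intro z hz
    have h1 : ‖z‖ ^ 2 / 2 < inner ℝ y z := by
      rw [hy, real_inner_smul_left, div_mul_eq_mul_div, lt_div_iff₀ hx]
      linarith
    rw [norm_sub_sq_real, hny, hR, real_inner_comm]
    linarith
  refine not_three_close (p := -y) (q := u - y) (s := w - y) ?_ (key u hxu) (key w hxw).le ?_ ?_ ?_
  · rw [norm_neg, hny, hR]
  · simpa [sub_eq_add_neg] using hu
  · simpa [sub_eq_add_neg] using hw
  · simpa using huw

theorem volume_capSector_ofReal_le {d : ℝ} (hd : 2 ≤ d) :
    volume (capSector (d : ℂ)) ≤ ENNReal.ofReal (4 / 3 * arccos (d / 2 / √(4 / 3))) := by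
  set R : ℝ := √(4 / 3) with hRdef
  have hR2 : R ^ 2 = 4 / 3 := Real.sq_sqrt (by norm_num)
  have hR : 0 < R := by positivity
  set θ := arccos (d / 2 / R) with hθ
  have hmeas : MeasurableSet (capSector (d : ℂ)) := (isOpen_capSector _).measurableSet
  have hle : volume (capSector (d : ℂ)) ≤
      ∫⁻ p in Set.Ioo 0 R ×ˢ Set.Icc (-θ) θ, ENNReal.ofReal p.1 := by
    rw [← lintegral_indicator_one hmeas, ← Complex.lintegral_comp_polarCoord_symm,
      ← lintegral_indicator (measurableSet_Ioo.prod measurableSet_Icc),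
      ← lintegral_indicator polarCoord.open_target.measurableSet]
    refine lintegral_mono fun p => ?_
    by_cases hp : p ∈ polarCoord.target
    swap
    · rw [Set.indicator_of_notMem hp]
      exact zero_le
    by_cases hq : Complex.polarCoord.symm p ∈ capSector (d : ℂ)
    swap
    · rw [Set.indicator_of_mem hp, Set.indicator_of_notMem hq, smul_zero]
      exact zero_le
    rw [Set.indicator_of_mem hp, Set.indicator_of_mem hq, Set.indicator_of_mem]
    · simp
    obtain ⟨hp1, hp2⟩ : 0 < p.1 ∧ (-π < p.2 ∧ p.2 < π) := by simpa [polarCoord] using hp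
    obtain ⟨hq1, hq2⟩ := hq
    rw [Complex.norm_polarCoord_symm, abs_of_pos hp1] at hq1 hq2
    refine ⟨⟨hp1, hq1⟩, abs_le.1 ?_⟩
    have hc : d / 2 / R < cos p.2 := by
      rw [div_lt_iff₀ hR]
      have hin : inner ℝ (Complex.polarCoord.symm p) (d : ℂ) = d * (p.1 * cos p.2) := by
        simp [Complex.polarCoord_symm_apply, Complex.inner, Complex.cos_ofReal_re]
      rw [hin, Complex.norm_real, Real.norm_of_nonneg (by linarith)] at hq2
      have h1 : 0 < p.1 * d := by positivity
      have h2 : (p.1 * d) * (d / 2) < (p.1 * d) * (cos p.2 * R) := by linarith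
      exact lt_of_mul_lt_mul_left h2 h1.le
    rw [hθ, ← Real.arccos_cos (abs_nonneg p.2) (abs_le.2 ⟨hp2.1.le, hp2.2.le⟩), Real.cos_abs]
    exact Real.arccos_le_arccos hc.le
  refine hle.trans (le_of_eq ?_)
  have hint : ∫⁻ x in Set.Ioo 0 R, ENNReal.ofReal x = ENNReal.ofReal (2 / 3) := by
    rw [← ofReal_integral_eq_lintegral_ofReal]
    · rw [← integral_Ioc_eq_integral_Ioo, ← intervalIntegral.integral_of_le hR.le, integral_id, hR2]
      norm_num
    · exact (continuous_id.integrableOn_Icc (a := 0) (b := R)).mono_set Set.Ioo_subset_Icc_self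
    · exact (ae_restrict_mem measurableSet_Ioo).mono fun x hx => hx.1.le
  rw [Measure.volume_eq_prod, ← Measure.prod_restrict,
    lintegral_prod _ (by fun_prop)]
  simp only [lintegral_const, Measure.restrict_apply_univ, Real.volume_Icc]
  rw [lintegral_mul_const _ (by fun_prop), hint, ← ENNReal.ofReal_mul (by norm_num)]
  congr 1
  ring

theorem volume_complex_triangle {h t : ℝ} (hh : 0 ≤ h) (ht : 0 ≤ t) :
    volume {z : ℂ | z.re ∈ Set.Ioo 0 h ∧ z.im ∈ Set.Ioo (-(t * z.re)) (t * z.re)} =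
      ENNReal.ofReal (t * h ^ 2) := by
  have hset : {z : ℂ | z.re ∈ Set.Ioo 0 h ∧ z.im ∈ Set.Ioo (-(t * z.re)) (t * z.re)} =
      Complex.measurableEquivRealProd ⁻¹'
        regionBetween (fun x => -(t * x)) (fun x => t * x) (Set.Ioo 0 h) := rfl
  rw [hset, Complex.volume_preserving_equiv_real_prod.measure_preimage_equiv,
    Measure.volume_eq_prod, volume_regionBetween_eq_integral]
  · rw [← integral_Ioc_eq_integral_Ioo, ← intervalIntegral.integral_of_le hh]
    have hfun : ((fun x => t * x) - fun x => -(t * x)) = fun x : ℝ => 2 * t * x := by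
      ext x
      simp only [Pi.sub_apply]
      ring
    rw [hfun, intervalIntegral.integral_const_mul, integral_id]
    congr 1
    ring
  · exact (Continuous.integrableOn_Icc (a := 0) (b := h) (by fun_prop)).mono_set
      Set.Ioo_subset_Icc_self
  · exact (Continuous.integrableOn_Icc (a := 0) (b := h) (by fun_prop)).mono_set
      Set.Ioo_subset_Icc_self
  · exact measurableSet_Ioo
  · intro x hx
    have := mul_nonneg ht hx.1.le
    linarith

theorem mul_le_sin_mul_cos {θ : ℝ} (h0 : 0 ≤ θ) (h1 : θ ≤ π / 6) :
    3 * √3 / (2 * π) * θ ≤ sin θ * cos θ := by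
  have hc := strictConcaveOn_sin_Icc.concaveOn.2
    (show 0 ∈ Set.Icc 0 π from ⟨le_rfl, pi_pos.le⟩)
    (show π / 3 ∈ Set.Icc 0 π from ⟨by positivity, by linarith [pi_pos]⟩)
    (show 0 ≤ 1 - 6 * θ / π by rw [sub_nonneg, div_le_one pi_pos]; linarith)
    (show 0 ≤ 6 * θ / π by positivity) (by ring)
  have h2 : (1 - 6 * θ / π) • (0 : ℝ) + (6 * θ / π) • (π / 3) = 2 * θ := by
    simp only [smul_eq_mul]
    field_simp
    ring
  rw [h2, sin_two_mul] at hc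
  simp only [smul_eq_mul, sin_zero, mul_zero, zero_add, sin_pi_div_three] at hc
  have h3 : 3 * √3 / (2 * π) * θ = 6 * θ / π * (√3 / 2) / 2 := by
    field_simp
    ring
  rw [h3]
  linarith

theorem volume_cap_ofReal_add_le {d : ℝ} (hd : 2 ≤ d) (hd' : d ≤ 2 * √(4 / 3)) :
    volume.real (cap (d : ℂ)) + 3 * √3 / (2 * π) * volume.real (capSector (d : ℂ)) ≤
      volume.real (capSector (d : ℂ)) := by
  set R : ℝ := √(4 / 3) with hRdef
  have hR2 : R ^ 2 = 4 / 3 := Real.sq_sqrt (by norm_num)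
  have hR : 0 < R := by positivity
  set h := d / 2 with hh
  have hh1 : 1 ≤ h := by linarith
  have hhR : h ≤ R := by linarith
  set θ := arccos (h / R) with hθ
  have hcos : cos θ = h / R :=
    Real.cos_arccos (by linarith [show 0 ≤ h / R by positivity]) ((div_le_one hR).2 hhR)
  have hθ0 : 0 ≤ θ := Real.arccos_nonneg _
  have hcpos : 0 < cos θ := by rw [hcos]; positivity
  have hsin : 0 ≤ sin θ := Real.sin_nonneg_of_nonneg_of_le_pi hθ0 (Real.arccos_le_pi _)
  have hθ1 : θ ≤ π / 6 := by
    rw [hθ, ← Real.arccos_cos (x := π / 6) (by positivity) (by linarith [pi_pos])]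
    refine Real.arccos_le_arccos ?_
    rw [Real.cos_pi_div_six, le_div_iff₀ hR, hRdef, div_mul_eq_mul_div,
      ← Real.sqrt_mul (by norm_num)]
    norm_num
    exact hh1
  set t := sin θ / cos θ with ht
  have ht0 : 0 ≤ t := by positivity
  have hhcos : h = R * cos θ := by rw [hcos]; field_simp
  have hth : h ^ 2 * (1 + t ^ 2) = R ^ 2 := by
    rw [hhcos, ht]
    field_simp
    linarith [Real.sin_sq_add_cos_sq θ]
  have hth' : t * h ^ 2 = 4 / 3 * (sin θ * cos θ) := by
    rw [hhcos, ht, ← hR2]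
    field_simp
  set T : Set ℂ := {z : ℂ | z.re ∈ Set.Ioo 0 h ∧ z.im ∈ Set.Ioo (-(t * z.re)) (t * z.re)} with hT
  have hinner : ∀ z : ℂ, inner ℝ z (d : ℂ) = 2 * h * z.re := by
    intro z
    have : inner ℝ z (d : ℂ) = d * z.re := by simp [Complex.inner]
    rw [this, hh]
    ring
  have hnd : ‖(d : ℂ)‖ = 2 * h := by
    rw [Complex.norm_real, Real.norm_of_nonneg (by linarith)]
    ring
  have hsec : ∀ z : ℂ, z ∈ capSector (d : ℂ) ↔ ‖z‖ < R ∧ ‖z‖ * h < R * z.re := by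
    intro z
    rw [capSector, Set.mem_ofPred_eq, hinner, hnd]
    refine and_congr_right fun _ => ?_
    rw [show ‖z‖ * (2 * h) ^ 2 / 2 = 2 * h * (‖z‖ * h) by ring,
      show R * (2 * h * z.re) = 2 * h * (R * z.re) by ring,
      mul_lt_mul_iff_right₀ (by linarith)]
  have hcap : ∀ z ∈ cap (d : ℂ), ‖z‖ < R ∧ h ≤ z.re := by
    rintro z ⟨hz1, hz2⟩
    refine ⟨hz1, ?_⟩
    have h1 := pow_le_pow_left₀ (norm_nonneg _) hz2 2
    rw [norm_sub_sq_real, hinner, hnd] at h1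
    nlinarith
  have hTS : T ⊆ capSector (d : ℂ) := by
    rintro z ⟨⟨hz1, hz2⟩, hz3, hz4⟩
    have him : z.im ^ 2 < (t * z.re) ^ 2 := sq_lt_sq' hz3 hz4
    have hn : ‖z‖ ^ 2 = z.re ^ 2 + z.im ^ 2 := by
      rw [Complex.sq_norm, Complex.normSq_apply]; ring
    have hn' : ‖z‖ ^ 2 < z.re ^ 2 * (1 + t ^ 2) := by rw [hn]; linarith
    rw [hsec]
    constructor
    · refine lt_of_pow_lt_pow_left₀ 2 hR.le (hn'.trans ?_)
      rw [← hth]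
      gcongr
    · refine lt_of_pow_lt_pow_left₀ 2 (by positivity) ?_
      have : ‖z‖ ^ 2 * h ^ 2 < z.re ^ 2 * (1 + t ^ 2) * h ^ 2 := by gcongr
      rw [mul_pow, mul_pow, ← hth]
      linarith
  have hCS : cap (d : ℂ) ⊆ capSector (d : ℂ) := by
    intro z hz
    obtain ⟨hz1, hz2⟩ := hcap z hz
    rw [hsec]
    exact ⟨hz1, mul_lt_mul hz1 hz2 (by linarith) hR.le⟩
  have hCT : Disjoint (cap (d : ℂ)) T := by
    rw [Set.disjoint_left]
    intro z hz hzT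
    exact absurd (hcap z hz).2 (not_le.2 hzT.1.2)
  have hTm : MeasurableSet T := by
    have : IsOpen T := by
      simp only [hT, Set.mem_Ioo, Set.ofPred_and]
      refine IsOpen.inter (IsOpen.inter ?_ ?_) (IsOpen.inter ?_ ?_) <;>
        exact isOpen_lt (by fun_prop) (by fun_prop)
    exact this.measurableSet
  have hSfin : volume (capSector (d : ℂ)) ≠ ⊤ :=
    ((volume_capSector_ofReal_le hd).trans_lt ENNReal.ofReal_lt_top).ne
  have hS : volume.real (capSector (d : ℂ)) ≤ 4 / 3 * θ :=
    ENNReal.toReal_le_of_le_ofReal (by positivity) (volume_capSector_ofReal_le hd)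
  have hTv : volume.real T = t * h ^ 2 := by
    rw [Measure.real, volume_complex_triangle (by linarith) ht0,
      ENNReal.toReal_ofReal (by positivity)]
  have hsum : volume.real (cap (d : ℂ)) + volume.real T ≤ volume.real (capSector (d : ℂ)) := by
    rw [← measureReal_union hCT hTm (measure_ne_top_of_subset hCS hSfin)
      (measure_ne_top_of_subset hTS hSfin)]
    exact measureReal_mono (Set.union_subset hCS hTS) hSfin
  have hfin := mul_le_sin_mul_cos hθ0 hθ1
  have : 3 * √3 / (2 * π) * volume.real (capSector (d : ℂ)) ≤ 3 * √3 / (2 * π) * (4 / 3 * θ) := by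
    gcongr
  linarith

theorem exists_linearIsometryEquiv_complex {u : EuclideanSpace ℝ (Fin 2)} (hu : u ≠ 0) :
    ∃ L : EuclideanSpace ℝ (Fin 2) ≃ₗᵢ[ℝ] ℂ, L u = ‖u‖ := by
  let L₀ : EuclideanSpace ℝ (Fin 2) ≃ₗᵢ[ℝ] ℂ := Complex.orthonormalBasisOneI.repr.symm
  have hn : ‖L₀ u‖ = ‖u‖ := L₀.norm_map u
  have hz : L₀ u ≠ 0 := by simpa using hu
  let b : Circle := ⟨(‖u‖ : ℂ) / L₀ u, by simp [Submonoid.unitSphere, hn, hu]⟩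
  refine ⟨L₀.trans (rotation b), ?_⟩
  change (‖u‖ : ℂ) / L₀ u * L₀ u = ‖u‖
  field_simp

theorem volume_cap_add_le {u : EuclideanSpace ℝ (Fin 2)} (hu : 2 ≤ ‖u‖)
    (hu' : ‖u‖ ≤ 2 * √(4 / 3)) :
    volume.real (cap u) + 3 * √3 / (2 * π) * volume.real (capSector u) ≤
      volume.real (capSector u) := by
  have hu0 : u ≠ 0 := norm_pos_iff.1 (by linarith)
  obtain ⟨L, hL⟩ := exists_linearIsometryEquiv_complex hu0
  have hcap : cap u = L.toMeasurableEquiv ⁻¹' cap (‖u‖ : ℂ) := by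
    ext x
    simp [cap, ← hL, ← map_sub]
  have hsec : capSector u = L.toMeasurableEquiv ⁻¹' capSector (‖u‖ : ℂ) := by
    ext x
    have : inner ℝ (L x) (L u) = inner ℝ x u := L.inner_map_map x u
    rw [Set.mem_preimage, capSector, capSector, Set.mem_ofPred_eq, Set.mem_ofPred_eq, ← hL]
    change _ ↔ ‖L x‖ < _ ∧ ‖L x‖ * ‖L u‖ ^ 2 / 2 < _ * inner ℝ (L x) (L u)
    rw [this, L.norm_map, L.norm_map]
  have hm : MeasurePreserving L.toMeasurableEquiv := L.measurePreserving
  rw [Measure.real, Measure.real, hcap, hsec, hm.measure_preimage_equiv, hm.measure_preimage_equiv]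
  exact volume_cap_ofReal_add_le hu hu'

theorem finite_inter_closedBall {E : Type*} [PseudoMetricSpace E] [ProperSpace E] {V : Set E}
    (hV : ∀ u ∈ V, ∀ v ∈ V, u ≠ v → 2 ≤ dist u v) (x : E) (r : ℝ) :
    (V ∩ closedBall x r).Finite := by
  obtain ⟨t, -, ht, hcov⟩ :=
    (isCompact_closedBall x r).finite_cover_balls (e := 1) one_pos
  refine (ht.biUnion (t := fun y => V ∩ ball y 1) fun y _ => Set.Subsingleton.finite ?_).subset ?_
  · rintro a ⟨haV, ha⟩ b ⟨hbV, hb⟩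
    by_contra hab
    have := hV a haV b hbV hab
    have := dist_triangle_right a b y
    rw [mem_ball] at ha hb
    linarith
  · rintro a ⟨haV, ha⟩
    obtain ⟨y, hy, hay⟩ := Set.mem_iUnion₂.1 (hcov ha)
    exact Set.mem_iUnion₂.2 ⟨y, hy, haV, hay⟩

theorem volume_real_ball {r : ℝ} (hr : 0 ≤ r) (x : EuclideanSpace ℝ (Fin 2)) :
    volume.real (ball x r) = π * r ^ 2 := by
  rw [Measure.real, EuclideanSpace.volume_ball_fin_two]
  simp [hr, pi_pos.le, mul_comm]

/-- The open Voronoi cell of `v` with respect to `V`, truncated at radius `√(4/3)`. -/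
def voronoiCell {E : Type*} [PseudoMetricSpace E] (V : Set E) (v : E) : Set E :=
  {x | dist x v < √(4 / 3) ∧ ∀ u ∈ V, u ≠ v → dist x v < dist x u}

theorem sqrt_twelve_le_volume_voronoiCell_zero {V : Set (EuclideanSpace ℝ (Fin 2))}
    (hV : ∀ u ∈ V, ∀ v ∈ V, u ≠ v → 2 ≤ dist u v) (h0 : 0 ∈ V) :
    √12 ≤ volume.real (voronoiCell V 0) := by
  set R : ℝ := √(4 / 3) with hRdef
  have hR2 : R ^ 2 = 4 / 3 := Real.sq_sqrt (by norm_num)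
  have hR : 0 < R := by positivity
  have hfin : {u | u ∈ V ∩ closedBall 0 (2 * R) ∧ u ≠ 0}.Finite :=
    (finite_inter_closedBall hV 0 (2 * R)).subset fun u hu => hu.1
  set F := hfin.toFinset with hF
  have hFmem : ∀ u, u ∈ F ↔ (u ∈ V ∧ ‖u‖ ≤ 2 * R) ∧ u ≠ 0 := by simp [hF]
  have hnorm : ∀ u ∈ F, 2 ≤ ‖u‖ := by
    intro u hu
    obtain ⟨⟨h1, -⟩, h2⟩ := (hFmem u).1 hu
    simpa using hV u h1 0 h0 h2
  have hsub : ball 0 R ⊆ voronoiCell V 0 ∪ ⋃ u ∈ F, cap u := by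
    intro x hx
    rw [mem_ball_zero_iff] at hx
    by_cases hxc : x ∈ voronoiCell V 0
    · exact Or.inl hxc
    right
    simp only [voronoiCell, Set.mem_ofPred_eq, dist_zero_right, not_and, not_forall, not_lt] at hxc
    obtain ⟨u, huV, hu0, hu⟩ := hxc hx
    rw [dist_eq_norm] at hu
    refine Set.mem_iUnion₂.2 ⟨u, (hFmem u).2 ⟨⟨huV, ?_⟩, hu0⟩, hx, hu⟩
    have := norm_sub_le x (x - u)
    rw [sub_sub_cancel] at this
    linarith
  have hballfin : volume (ball (0 : EuclideanSpace ℝ (Fin 2)) R) ≠ ⊤ := measure_ball_lt_top.ne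
  have hcellball : voronoiCell V 0 ⊆ ball 0 R := fun x hx => hx.1
  have h1 : π * R ^ 2 ≤ volume.real (voronoiCell V 0) + ∑ u ∈ F, volume.real (cap u) := by
    rw [← volume_real_ball hR.le 0]
    refine (measureReal_mono hsub ?_).trans ((measureReal_union_le _ _).trans ?_)
    · exact measure_ne_top_of_subset (Set.union_subset hcellball
        (Set.iUnion₂_subset fun u _ => cap_subset_ball u)) hballfin
    · gcongr
      exact measureReal_biUnion_finset_le _ _
  have h2 : ∑ u ∈ F, volume.real (capSector u) ≤ π * R ^ 2 := by
    rw [← volume_real_ball hR.le 0, ← measureReal_biUnion_finset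
      (h := fun u _ => measure_ne_top_of_subset (capSector_subset_ball u) hballfin)]
    · exact measureReal_mono (Set.iUnion₂_subset fun u _ => capSector_subset_ball u) hballfin
    · intro u hu w hw huw
      refine disjoint_capSector (hnorm u hu) (hnorm w hw) ?_
      rw [← dist_eq_norm]
      exact hV u ((hFmem u).1 hu).1.1 w ((hFmem w).1 hw).1.1 huw
    · exact fun u _ => (isOpen_capSector u).measurableSet
  have h3 : ∑ u ∈ F, volume.real (cap u) ≤
      (1 - 3 * √3 / (2 * π)) * ∑ u ∈ F, volume.real (capSector u) := by
    rw [Finset.mul_sum]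
    refine Finset.sum_le_sum fun u hu => ?_
    have := volume_cap_add_le (hnorm u hu) ((hFmem u).1 hu).1.2
    linarith
  have h4 : 0 ≤ 1 - 3 * √3 / (2 * π) := by
    have : √3 ≤ 2 := Real.sqrt_le_iff.2 ⟨by norm_num, by norm_num⟩
    rw [sub_nonneg, div_le_one (by positivity)]
    linarith [pi_gt_three]
  have h5 : √12 = 2 * √3 := by
    rw [show (12 : ℝ) = 2 ^ 2 * 3 by norm_num, Real.sqrt_mul (by norm_num),
      Real.sqrt_sq (by norm_num)]
  have h6 := mul_le_mul_of_nonneg_left h2 h4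
  have h7 : (1 - 3 * √3 / (2 * π)) * (π * R ^ 2) = π * R ^ 2 - √12 := by
    rw [h5, hR2]
    field_simp
    ring
  linarith

theorem sqrt_twelve_le_volume_voronoiCell {V : Set (EuclideanSpace ℝ (Fin 2))}
    (hV : ∀ u ∈ V, ∀ v ∈ V, u ≠ v → 2 ≤ dist u v) {v : EuclideanSpace ℝ (Fin 2)} (hv : v ∈ V) :
    √12 ≤ volume.real (voronoiCell V v) := by
  have h := sqrt_twelve_le_volume_voronoiCell_zero (V := (· + v) ⁻¹' V)
    (fun a ha b hb hab => by simpa using hV _ ha _ hb (by simpa using hab)) (by simpa using hv)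
  have hcell : voronoiCell ((· + v) ⁻¹' V) 0 = (· + v) ⁻¹' voronoiCell V v := by
    ext x
    simp only [voronoiCell, Set.mem_preimage, Set.mem_ofPred_eq]
    refine and_congr (by simp [dist_eq_norm]) ⟨fun H u hu huv => ?_, fun H u hu hu0 => ?_⟩
    · have := H (u - v) (by simpa using hu) (sub_ne_zero.2 huv)
      simpa [dist_eq_norm, sub_sub_eq_add_sub] using this
    · simpa [dist_eq_norm] using H (u + v) hu (by simpa using hu0)
  rwa [hcell, Measure.real, measure_preimage_add_right] at h

theorem countable_of_two_le_dist {E : Type*} [PseudoMetricSpace E] [ProperSpace E] {V : Set E}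
    (hV : ∀ u ∈ V, ∀ v ∈ V, u ≠ v → 2 ≤ dist u v) : V.Countable := by
  rcases V.eq_empty_or_nonempty with rfl | ⟨x, -⟩
  · exact Set.countable_empty
  · rw [← Metric.iUnion_inter_closedBall_nat V x]
    exact Set.countable_iUnion fun n => (finite_inter_closedBall hV x n).countable

theorem measurableSet_voronoiCell {E : Type*} [PseudoMetricSpace E] [MeasurableSpace E]
    [OpensMeasurableSpace E] {V : Set E} (hV : V.Countable) (v : E) :
    MeasurableSet (voronoiCell V v) := by
  have : voronoiCell V v =
      ball v (√(4 / 3)) ∩ ⋂ u ∈ V, {x | u ≠ v → dist x v < dist x u} := by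
    ext x
    simp [voronoiCell]
  rw [this]
  refine measurableSet_ball.inter (MeasurableSet.biInter hV fun u _ => ?_)
  by_cases h : u = v
  · simp [h]
  · simpa [h] using (isOpen_lt (continuous_id.dist continuous_const)
      (continuous_id.dist continuous_const)).measurableSet

theorem thue_theorem
    (V : Set (EuclideanSpace ℝ (Fin 2)))
    (hV : ∀ u ∈ V, ∀ v ∈ V, u ≠ v → 2 ≤ dist u v) :
    ∃ c : ℝ, ∀ r : ℝ, 1 ≤ r →
      ((V ∩ closedBall 0 r).ncard : ℝ) ≤ π * r ^ 2 / Real.sqrt 12 + c * r := by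
  set R : ℝ := √(4 / 3) with hRdef
  have hR : 0 < R := by positivity
  refine ⟨(2 * π * R + π * R ^ 2) / √12, fun r hr => ?_⟩
  have hfin := finite_inter_closedBall hV 0 r
  rw [Set.ncard_eq_toFinset_card _ hfin]
  set F := hfin.toFinset with hF
  have hFmem : ∀ u, u ∈ F ↔ u ∈ V ∧ ‖u‖ ≤ r := by simp [hF]
  have hsub : ∀ v ∈ F, voronoiCell V v ⊆ ball 0 (r + R) := by
    intro v hv x hx
    have h1 := ((hFmem v).1 hv).2
    have h2 : dist x v < R := hx.1
    have h3 := dist_triangle x v 0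
    rw [dist_zero_right v] at h3
    rw [mem_ball]
    linarith
  have hballfin : volume (ball (0 : EuclideanSpace ℝ (Fin 2)) (r + R)) ≠ ⊤ :=
    measure_ball_lt_top.ne
  have hsum : ∑ v ∈ F, volume.real (voronoiCell V v) ≤ π * (r + R) ^ 2 := by
    rw [← volume_real_ball (by linarith) 0, ← measureReal_biUnion_finset
      (h := fun v hv => measure_ne_top_of_subset (hsub v hv) hballfin)]
    · exact measureReal_mono (Set.iUnion₂_subset hsub) hballfin
    · intro u hu w hw huw
      refine Set.disjoint_left.2 fun x hxu hxw => ?_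
      exact lt_asymm (hxu.2 w ((hFmem w).1 hw).1 huw.symm) (hxw.2 u ((hFmem u).1 hu).1 huw)
    · exact fun v _ => measurableSet_voronoiCell (countable_of_two_le_dist hV) v
  have hcard : F.card * √12 ≤ π * (r + R) ^ 2 := by
    refine le_trans ?_ hsum
    rw [← nsmul_eq_mul]
    exact Finset.card_nsmul_le_sum _ _ _ fun v hv =>
      sqrt_twelve_le_volume_voronoiCell hV ((hFmem v).1 hv).1
  rw [div_mul_eq_mul_div, ← add_div, le_div_iff₀ (by positivity)]
  nlinarith [mul_nonneg (mul_nonneg pi_pos.le (sq_nonneg R)) (sub_nonneg.2 hr)]
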